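/- Let k ≥ 1 and suppose the (1,k)-FGC instance on G=(V,E) is feasible, with optimal value OPT. Fix r ∈ V and let D be the directed multigraph containing one bidirected pair of arcs for each unsafe edge and k+1 bidirected pairs for each safe edge, each arc arising from an edge e having cost c_e. Then D contains an r-rooted (k+1)-arborescence, and for any minimum-cost r-rooted (k+1)-arborescence T in D, the edge set F = { e ∈ E : at least one arc arising from e belongs to T } is feasible for (1,k)-FGC and satisfies c(F) ≤ (k+1)·OPT. -/

import Mathlib

/-!
The full reduction for (1,k)-FGC: if the instance is feasible with optimal value `OPT`,
then the digraph `D` (one bidirected pair per unsafe edge of `G`, `k+1` bidirected pairs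
per safe edge of `G`) contains an `r`-rooted `(k+1)`-arborescence, and for any
minimum-cost such arborescence `T`, the induced edge set is feasible for (1,k)-FGC with
cost at most `(k+1)·OPT`.

Arcs are modeled by triples `(e, i, b) : E × Fin (k+1) × Bool` (orientation `b`,
copy index `i`; unsafe edges only have the copy `i = 0`).
-/

/-- The set of edges of `F` having exactly one endpoint in `S`, i.e. `F ∩ δ(S)`. -/
def cutEdges {V E : Type*} [DecidableEq V] (ends : E → V × V) (F : Finset E)
    (S : Finset V) : Finset E :=
  F.filter fun e => ¬(((ends e).1 ∈ S) ↔ ((ends e).2 ∈ S))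

/-- `F` is feasible for (p,q)-FGC. -/
def FGCFeasible {V E : Type*} [Fintype V] [DecidableEq V] [DecidableEq E]
    (ends : E → V × V) (safeE : Finset E) (p q : ℕ) (F : Finset E) : Prop :=
  ∀ F' : Finset E, (∀ e ∈ F', e ∉ safeE) → F'.card ≤ q →
    ∀ S : Finset V, S.Nonempty → S ≠ Finset.univ →
      p ≤ (cutEdges ends (F \ F') S).card

/-- Acyclicity of the underlying undirected multigraph of an arc set. -/
def UndirAcyclic {W A : Type*} [DecidableEq W] (arcs : A → W × W) (T : Finset A) : Prop :=
  ∀ T' ⊆ T, T'.Nonempty →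
    T'.card < ((T'.image fun a => (arcs a).1) ∪ (T'.image fun a => (arcs a).2)).card

/-- `T` is an `r`-rooted arborescence. -/
def IsArborescence {W A : Type*} [DecidableEq W] (arcs : A → W × W) (r : W)
    (T : Finset A) : Prop :=
  UndirAcyclic arcs T ∧
    ∀ v : W, Relation.ReflTransGen (fun x y => ∃ a ∈ T, arcs a = (x, y)) r v

/-- `T` is an `r`-rooted `k`-arborescence: a union of `k` arc-disjoint `r`-rooted
arborescences. -/
def IsKArborescence {W A : Type*} [DecidableEq W] [DecidableEq A] (arcs : A → W × W)
    (r : W) (k : ℕ) (T : Finset A) : Prop :=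
  ∃ P : Fin k → Finset A,
    (∀ i, IsArborescence arcs r (P i)) ∧
    (∀ i j, i ≠ j → Disjoint (P i) (P j)) ∧
    Finset.univ.biUnion P = T

/-- The arc `(e, i, b)` arising from edge `e`: `b` chooses the orientation. -/
def arcEnds {V E : Type*} (ends : E → V × V) (k : ℕ) (a : E × Fin (k + 1) × Bool) :
    V × V :=
  if a.2.2 then ends a.1 else ((ends a.1).2, (ends a.1).1)

/-- Arcs of `B` entering `S`. -/
def inArcs {W A : Type*} [DecidableEq W] (arcs : A → W × W) (B : Finset A) (S : Finset W) :
    Finset A :=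
  B.filter fun a => (arcs a).1 ∉ S ∧ (arcs a).2 ∈ S

theorem inArcs_submod {W A : Type*} [DecidableEq W] (arcs : A → W × W) (B : Finset A)
    (X Y : Finset W) :
    (inArcs arcs B (X ∩ Y)).card + (inArcs arcs B (X ∪ Y)).card ≤
      (inArcs arcs B X).card + (inArcs arcs B Y).card := by
  unfold inArcs
  simp only [Finset.card_filter]
  rw [← Finset.sum_add_distrib, ← Finset.sum_add_distrib]
  apply Finset.sum_le_sum
  intro a _
  simp only [Finset.mem_inter, Finset.mem_union]
  by_cases h1 : (arcs a).1 ∈ X <;> by_cases h2 : (arcs a).1 ∈ Y <;>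
  by_cases h3 : (arcs a).2 ∈ X <;> by_cases h4 : (arcs a).2 ∈ Y <;> simp [h1, h2, h3, h4]

theorem undirAcyclic_insert {W A : Type*} [DecidableEq W] [DecidableEq A] (arcs : A → W × W)
    (T : Finset A) (U : Finset W) (hT : UndirAcyclic arcs T)
    (hU : ∀ a ∈ T, (arcs a).1 ∈ U ∧ (arcs a).2 ∈ U) (a : A)
    (h1 : (arcs a).1 ∈ U) (h2 : (arcs a).2 ∉ U) : UndirAcyclic arcs (insert a T) := by
  intro T' hT' hne
  by_cases ha : a ∈ T'
  · have hsub : T'.erase a ⊆ T := by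
      intro x hx
      rw [Finset.mem_erase] at hx
      exact (Finset.mem_insert.1 (hT' hx.2)).resolve_left hx.1
    have hcard := Finset.card_erase_add_one ha
    rcases (T'.erase a).eq_empty_or_nonempty with he | hn
    · rw [he] at hcard
      have : ({(arcs a).1, (arcs a).2} : Finset W) ⊆
          ((T'.image fun a => (arcs a).1) ∪ (T'.image fun a => (arcs a).2)) := by
        intro x hx
        simp only [Finset.mem_insert, Finset.mem_singleton] at hx
        simp only [Finset.mem_union, Finset.mem_image]
        rcases hx with rfl | rfl
        · exact Or.inl ⟨a, ha, rfl⟩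
        · exact Or.inr ⟨a, ha, rfl⟩
      have h3 := Finset.card_le_card this
      rw [Finset.card_pair (by intro h; rw [h] at h1; exact h2 h1)] at h3
      simp at hcard
      omega
    · have h3 := hT _ hsub hn
      set R := (((T'.erase a).image fun a => (arcs a).1) ∪
        ((T'.erase a).image fun a => (arcs a).2)) with hR
      have hvR : (arcs a).2 ∉ R := by
        intro h
        simp only [hR, Finset.mem_union, Finset.mem_image] at h
        rcases h with ⟨b, hb, hb2⟩ | ⟨b, hb, hb2⟩
        · exact h2 (hb2 ▸ (hU b (hsub hb)).1)
        · exact h2 (hb2 ▸ (hU b (hsub hb)).2)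
      have : insert (arcs a).2 R ⊆
          ((T'.image fun a => (arcs a).1) ∪ (T'.image fun a => (arcs a).2)) := by
        intro x hx
        simp only [hR, Finset.mem_insert, Finset.mem_union, Finset.mem_image] at hx
        simp only [Finset.mem_union, Finset.mem_image]
        rcases hx with rfl | ⟨b, hb, rfl⟩ | ⟨b, hb, rfl⟩
        · exact Or.inr ⟨a, ha, rfl⟩
        · exact Or.inl ⟨b, Finset.mem_of_mem_erase hb, rfl⟩
        · exact Or.inr ⟨b, Finset.mem_of_mem_erase hb, rfl⟩
      have h4 := Finset.card_le_card this
      rw [Finset.card_insert_of_notMem hvR] at h4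
      omega
  · apply hT T' _ hne
    intro x hx
    exact (Finset.mem_insert.1 (hT' hx)).resolve_left (fun h => ha (h ▸ hx))

/-- The extension step of the Lovász proof of the Edmonds theorem. -/
theorem exists_ext {W A : Type*} [Fintype W] [DecidableEq W] [DecidableEq A]
    (arcs : A → W × W) (r : W) (k : ℕ) (B : Finset A)
    (hB : ∀ S : Finset W, S.Nonempty → r ∉ S → k + 1 ≤ (inArcs arcs B S).card)
    (U : Finset W) (T : Finset A) (hr : r ∈ U) (hUne : U ≠ Finset.univ)
    (hTU : ∀ a ∈ T, (arcs a).1 ∈ U ∧ (arcs a).2 ∈ U)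
    (hd : ∀ S : Finset W, S.Nonempty → r ∉ S → k ≤ (inArcs arcs (B \ T) S).card) :
    ∃ a ∈ B, (arcs a).1 ∈ U ∧ (arcs a).2 ∉ U ∧
      ∀ S : Finset W, S.Nonempty → r ∉ S → k ≤ (inArcs arcs (B \ insert a T) S).card := by
  classical
  -- sets disjoint from `U` keep indegree `k + 1`
  have hdis : ∀ S : Finset W, S.Nonempty → (∀ x ∈ S, x ∉ U) →
      k + 1 ≤ (inArcs arcs (B \ T) S).card := by
    intro S hS hSU
    refine (hB S hS (fun h => hSU r h hr)).trans (Finset.card_le_card ?_)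
    intro a ha
    simp only [inArcs, Finset.mem_filter, Finset.mem_sdiff] at ha ⊢
    exact ⟨⟨ha.1, fun h => hSU _ ha.2.2 (hTU a h).2⟩, ha.2⟩
  let Q : Finset W → Prop := fun X => (X \ U).Nonempty ∧
    (X = Finset.univ ∨ (r ∉ X ∧ (inArcs arcs (B \ T) X).card ≤ k))
  have hne : ((Finset.univ : Finset (Finset W)).filter Q).Nonempty := by
    refine ⟨Finset.univ, ?_⟩
    simp only [Finset.mem_filter, Finset.mem_univ, true_and, Q, true_or, and_true]
    rw [Finset.sdiff_nonempty]
    intro h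
    exact hUne (Finset.univ_subset_iff.1 h)
  obtain ⟨X, hX, hmin⟩ := Finset.exists_min_image _ Finset.card hne
  simp only [Finset.mem_filter, Finset.mem_univ, true_and] at hX hmin
  -- find an arc from `X ∩ U` to `X \ U`
  have harc : ∃ a ∈ B \ T, (arcs a).1 ∈ X ∧ (arcs a).1 ∈ U ∧
      (arcs a).2 ∈ X ∧ (arcs a).2 ∉ U := by
    have h1 := hdis (X \ U) hX.1 (fun x hx => (Finset.mem_sdiff.1 hx).2)
    by_contra hcon
    push Not at hcon
    have hsub : inArcs arcs (B \ T) (X \ U) ⊆ inArcs arcs (B \ T) X := by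
      intro a ha
      simp only [inArcs, Finset.mem_filter] at ha ⊢
      obtain ⟨haB, h2, h3⟩ := ha
      rw [Finset.mem_sdiff] at h2 h3
      refine ⟨haB, fun h4 => ?_, h3.1⟩
      have h5 : (arcs a).1 ∈ U := by
        by_contra h6
        exact h2 ⟨h4, h6⟩
      exact h3.2 (hcon a haB h4 h5 h3.1)
    have h2 := Finset.card_le_card hsub
    rcases hX.2 with h | ⟨_, h⟩
    · have : inArcs arcs (B \ T) X = ∅ := by
        rw [h]; simp [inArcs]
      rw [this] at h2
      simp at h2
      simp [h2] at h1
    · omega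
  obtain ⟨a, haB, ha1X, ha1U, ha2X, ha2U⟩ := harc
  refine ⟨a, (Finset.mem_sdiff.1 haB).1, ha1U, ha2U, ?_⟩
  intro S hS hrS
  have herase : inArcs arcs (B \ insert a T) S = (inArcs arcs (B \ T) S).erase a := by
    ext x
    simp only [inArcs, Finset.mem_filter, Finset.mem_sdiff, Finset.mem_insert, Finset.mem_erase]
    tauto
  rw [herase]
  by_cases hmem : a ∈ inArcs arcs (B \ T) S
  · rw [Finset.card_erase_of_mem hmem]
    by_contra hlt
    have hle : (inArcs arcs (B \ T) S).card ≤ k := by omega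
    simp only [inArcs, Finset.mem_filter] at hmem
    have hQ : Q (X ∩ S) := by
      refine ⟨⟨(arcs a).2, by simp [ha2X, ha2U, hmem.2.2]⟩, Or.inr ⟨by simp [hrS], ?_⟩⟩
      rcases hX.2 with h | ⟨hrX, h⟩
      · rw [h, Finset.univ_inter]; exact hle
      · have h1 := inArcs_submod arcs (B \ T) X S
        have h2 := hd (X ∪ S) (hS.mono Finset.subset_union_right) (by simp [hrX, hrS])
        omega
    have h1 := hmin _ hQ
    have h2 : (X ∩ S).card < X.card := by
      apply Finset.card_lt_card
      refine ⟨Finset.inter_subset_left, fun h => ?_⟩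
      exact hmem.2.1 (Finset.mem_inter.1 (h ha1X)).2
    omega
  · rw [Finset.erase_eq_of_notMem hmem]
    exact hd S hS hrS

theorem exists_arb {W A : Type*} [Fintype W] [DecidableEq W] [DecidableEq A]
    (arcs : A → W × W) (r : W) (k : ℕ) (B : Finset A)
    (hB : ∀ S : Finset W, S.Nonempty → r ∉ S → k + 1 ≤ (inArcs arcs B S).card) (n : ℕ) :
    ∀ (U : Finset W) (T : Finset A), Uᶜ.card = n → r ∈ U → T ⊆ B →
    (∀ a ∈ T, (arcs a).1 ∈ U ∧ (arcs a).2 ∈ U) →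
    UndirAcyclic arcs T →
    (∀ v ∈ U, Relation.ReflTransGen (fun x y => ∃ a ∈ T, arcs a = (x, y)) r v) →
    (∀ S : Finset W, S.Nonempty → r ∉ S → k ≤ (inArcs arcs (B \ T) S).card) →
    ∃ T' ⊆ B, IsArborescence arcs r T' ∧
      ∀ S : Finset W, S.Nonempty → r ∉ S → k ≤ (inArcs arcs (B \ T') S).card := by
  induction n with
  | zero =>
    intro U T hU _ hTB _ hac hreach hd
    have hU' : U = Finset.univ := by simpa using hU
    exact ⟨T, hTB, ⟨hac, fun v => hreach v (by simp [hU'])⟩, hd⟩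
  | succ n ih =>
    intro U T hU hr hTB hTU hac hreach hd
    obtain ⟨a, haB, h1, h2, hd'⟩ := exists_ext arcs r k B hB U T hr
      (by rintro rfl; simp at hU) hTU hd
    have hmono : ∀ v, Relation.ReflTransGen (fun x y => ∃ a ∈ T, arcs a = (x, y)) r v →
        Relation.ReflTransGen (fun x y => ∃ b ∈ insert a T, arcs b = (x, y)) r v := by
      intro v hv
      induction hv with
      | refl => exact Relation.ReflTransGen.refl
      | tail _ hbc ih2 =>
        obtain ⟨b, hb, hb2⟩ := hbc
        exact ih2.tail ⟨b, Finset.mem_insert_of_mem hb, hb2⟩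
    refine ih (insert (arcs a).2 U) (insert a T) ?_ (Finset.mem_insert_of_mem hr)
      (Finset.insert_subset haB hTB) ?_ (undirAcyclic_insert arcs T U hac hTU a h1 h2) ?_ hd'
    · rw [Finset.card_compl] at hU ⊢
      rw [Finset.card_insert_of_notMem h2]
      omega
    · intro b hb
      rcases Finset.mem_insert.1 hb with rfl | hb
      · simp [h1]
      · exact ⟨Finset.mem_insert_of_mem (hTU b hb).1, Finset.mem_insert_of_mem (hTU b hb).2⟩
    · intro v hv
      rcases Finset.mem_insert.1 hv with rfl | hv
      · exact (hmono _ (hreach _ h1)).tail ⟨a, Finset.mem_insert_self _ _, rfl⟩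
      · exact hmono _ (hreach v hv)

/-- The Edmonds disjoint arborescences theorem. -/
theorem edmonds {W A : Type*} [Fintype W] [DecidableEq W] [DecidableEq A]
    (arcs : A → W × W) (r : W) (k : ℕ) : ∀ (B : Finset A),
    (∀ S : Finset W, S.Nonempty → r ∉ S → k ≤ (inArcs arcs B S).card) →
    ∃ P : Fin k → Finset A, (∀ i, IsArborescence arcs r (P i)) ∧
      (∀ i j, i ≠ j → Disjoint (P i) (P j)) ∧ ∀ i, P i ⊆ B := by
  induction k with
  | zero => exact fun B _ => ⟨fun _ => ∅, fun i => i.elim0, fun i => i.elim0, fun i => i.elim0⟩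
  | succ k ih =>
    intro B hB
    obtain ⟨T, hTB, hT, hd⟩ := exists_arb arcs r k B hB _ {r} ∅ rfl (by simp) (by simp) (by simp)
      (by
        intro T' h hne
        rw [Finset.subset_empty.1 h] at hne
        simp at hne)
      (by
        intro v hv
        rw [Finset.mem_singleton.1 hv])
      (by
        intro S hS hr
        rw [Finset.sdiff_empty]
        have := hB S hS hr
        omega)
    obtain ⟨P, hP, hdisj, hsub⟩ := ih (B \ T) hd
    have hTP : ∀ i, Disjoint T (P i) := fun i =>
      (Finset.disjoint_sdiff).mono_right (hsub i)
    refine ⟨Fin.cons T P, ?_, ?_, ?_⟩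
    · intro i
      refine Fin.cases ?_ (fun i => ?_) i
      · simpa using hT
      · simpa using hP i
    · intro i j
      refine Fin.cases ?_ (fun i => ?_) i
      · refine Fin.cases ?_ (fun j => ?_) j
        · simp
        · intro _
          simpa using hTP j
      · refine Fin.cases ?_ (fun j => ?_) j
        · intro _
          simpa using (hTP i).symm
        · intro h
          simpa using hdisj i j (fun h' => h (by rw [h']))
    · intro i
      refine Fin.cases ?_ (fun i => ?_) i
      · simpa using hTB
      · simpa using (hsub i).trans Finset.sdiff_subset

/-- A reachability relation crosses every cut. -/
theorem exists_cross {W : Type*} (R : W → W → Prop) (p : W → Prop) (r v : W)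
    (h : Relation.ReflTransGen R r v) (hr : p r) (hv : ¬ p v) :
    ∃ x y, R x y ∧ p x ∧ ¬ p y := by
  induction h with
  | refl => exact absurd hr hv
  | @tail b c _ hbc ih =>
    by_cases hb : p b
    · exact ⟨b, c, hbc, hb, hv⟩
    · exact ih hb

theorem arb_feasible {V E : Type*} [Fintype V] [DecidableEq V] [DecidableEq E]
    (ends : E → V × V) (safeE : Finset E) (k : ℕ) (r : V)
    (T : Finset (E × Fin (k + 1) × Bool)) (hT : ∀ a ∈ T, a.1 ∈ safeE ∨ a.2.1 = 0)
    (hK : IsKArborescence (arcEnds ends k) r (k + 1) T) :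
    FGCFeasible ends safeE 1 k (T.image Prod.fst) := by
  intro F' hF' hcard S hS hSu
  obtain ⟨P, hP, hdisj, rfl⟩ := hK
  have hcross : ∀ i, ∃ a ∈ P i, ((arcEnds ends k a).1 ∈ S ↔ r ∈ S) ∧
      ¬ ((arcEnds ends k a).2 ∈ S ↔ r ∈ S) := by
    intro i
    obtain ⟨v, hv⟩ : ∃ v, ¬ (v ∈ S ↔ r ∈ S) := by
      by_cases hr : r ∈ S
      · by_contra hcon
        push Not at hcon
        exact hSu (Finset.eq_univ_of_forall fun v => (hcon v).2 hr)
      · obtain ⟨v, hv⟩ := hS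
        exact ⟨v, fun h => hr (h.1 hv)⟩
    obtain ⟨x, y, ⟨a, ha, hxy⟩, hx, hy⟩ :=
      exists_cross _ (fun v => v ∈ S ↔ r ∈ S) r v ((hP i).2 v) Iff.rfl hv
    refine ⟨a, ha, ?_⟩
    rw [hxy]
    exact ⟨hx, hy⟩
  choose f hfP hf1 hf2 using hcross
  have hcut : ∀ i, ¬ (((ends (f i).1).1 ∈ S) ↔ ((ends (f i).1).2 ∈ S)) := by
    intro i h
    have h1 := hf1 i
    have h2 := hf2 i
    unfold arcEnds at h1 h2
    split_ifs at h1 h2 <;> tauto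
  have hfT : ∀ i, f i ∈ Finset.univ.biUnion P := fun i =>
    Finset.mem_biUnion.2 ⟨i, Finset.mem_univ _, hfP i⟩
  obtain ⟨i, hi⟩ : ∃ i, (f i).1 ∉ F' := by
    by_contra hcon
    push Not at hcon
    have hinj : Function.Injective (fun i => (f i).1) := by
      intro i j hij
      simp only at hij
      have h0 : ∀ i, (f i).2.1 = 0 := fun i =>
        (hT _ (hfT i)).resolve_left (hF' _ (hcon i))
      have hb : (f i).2.2 = (f j).2.2 := by
        have h1 := hf1 i
        have h2 := hf2 i
        have h3 := hf1 j
        have h4 := hf2 j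
        unfold arcEnds at h1 h2 h3 h4
        rw [hij] at h1 h2
        cases hbi : (f i).2.2 <;> cases hbj : (f j).2.2 <;>
          simp [hbi, hbj] at h1 h2 h3 h4 ⊢ <;> tauto
      have heq : f i = f j := by
        refine Prod.ext hij (Prod.ext ?_ hb)
        rw [h0 i, h0 j]
      by_contra hne
      exact Finset.disjoint_left.1 (hdisj i j hne) (hfP i) (heq ▸ hfP j)
    have := Finset.card_le_card_of_injOn (s := Finset.univ) (t := F') (fun i => (f i).1)
      (fun i _ => hcon i) hinj.injOn
    simp at this
    omega
  apply Finset.card_pos.2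
  refine ⟨(f i).1, ?_⟩
  simp only [cutEdges, Finset.mem_filter, Finset.mem_sdiff]
  exact ⟨⟨Finset.mem_image_of_mem _ (hfT i), hi⟩, hcut i⟩

theorem arb_inj {V E : Type*} [DecidableEq V] [DecidableEq E]
    (ends : E → V × V) (k : ℕ) (P : Finset (E × Fin (k + 1) × Bool))
    (hP : UndirAcyclic (arcEnds ends k) P) :
    Set.InjOn Prod.fst (P : Set (E × Fin (k + 1) × Bool)) := by
  intro a ha b hb hab
  by_contra hne
  have h := hP {a, b} (by
    intro x hx
    rcases Finset.mem_insert.1 hx with rfl | hx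
    · exact ha
    · rw [Finset.mem_singleton.1 hx]; exact hb) ⟨a, by simp⟩
  rw [Finset.card_pair hne] at h
  have hsub : (({a, b} : Finset (E × Fin (k + 1) × Bool)).image
      (fun a => (arcEnds ends k a).1) ∪ ({a, b} : Finset (E × Fin (k + 1) × Bool)).image
      (fun a => (arcEnds ends k a).2)) ⊆ {(ends a.1).1, (ends a.1).2} := by
    intro x hx
    simp only [Finset.mem_union, Finset.mem_image, Finset.mem_insert,
      Finset.mem_singleton] at hx ⊢
    unfold arcEnds at hx
    rcases hx with ⟨y, rfl | rfl, rfl⟩ | ⟨y, rfl | rfl, rfl⟩ <;> split_ifs <;> simp [hab]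
  have h2 := Finset.card_le_card hsub
  have h3 := Finset.card_le_two (a := (ends a.1).1) (b := (ends a.1).2)
  omega

theorem exists_karb {V E : Type*} [Fintype V] [DecidableEq V] [Fintype E] [DecidableEq E]
    (ends : E → V × V) (safeE : Finset E) (c : E → ℝ) (hc : ∀ e, 0 ≤ c e)
    (k : ℕ) (r : V) (F : Finset E) (hF : FGCFeasible ends safeE 1 k F) :
    ∃ T : Finset (E × Fin (k + 1) × Bool),
        (∀ a ∈ T, a.1 ∈ safeE ∨ a.2.1 = 0) ∧
        IsKArborescence (arcEnds ends k) r (k + 1) T ∧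
        ∑ a ∈ T, c a.1 ≤ ((k : ℝ) + 1) * ∑ e ∈ F, c e := by
  classical
  let B : Finset (E × Fin (k + 1) × Bool) :=
    Finset.univ.filter fun a => a.1 ∈ F ∧ (a.1 ∈ safeE ∨ a.2.1 = 0)
  have hmemB : ∀ a, a ∈ B ↔ a.1 ∈ F ∧ (a.1 ∈ safeE ∨ a.2.1 = 0) := by
    intro a
    simp [B]
  have hB : ∀ S : Finset V, S.Nonempty → r ∉ S →
      k + 1 ≤ (inArcs (arcEnds ends k) B S).card := by
    intro S hS hr
    have hSu : S ≠ Finset.univ := by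
      rintro rfl
      simp at hr
    have hin : ∀ e ∈ cutEdges ends F S, ∀ i : Fin (k + 1), (e ∈ safeE ∨ i = 0) →
        (e, i, decide ((ends e).2 ∈ S)) ∈ inArcs (arcEnds ends k) B S := by
      intro e he i hi
      simp only [cutEdges, Finset.mem_filter] at he
      simp only [inArcs, Finset.mem_filter, hmemB]
      refine ⟨⟨he.1, hi⟩, ?_⟩
      have h2 := he.2
      unfold arcEnds
      by_cases h : (ends e).2 ∈ S
      · simp [h] at h2 ⊢
        exact h2
      · simp [h] at h2 ⊢
        exact h2
    by_cases hs : ∃ e ∈ cutEdges ends F S, e ∈ safeE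
    · obtain ⟨e, he, hes⟩ := hs
      have := Finset.card_le_card_of_injOn (s := (Finset.univ : Finset (Fin (k + 1))))
        (t := inArcs (arcEnds ends k) B S) (fun i => (e, i, decide ((ends e).2 ∈ S)))
        (fun i _ => hin e he i (Or.inl hes))
        (by
          intro i _ j _ hij
          simpa using hij)
      simpa using this
    · push Not at hs
      have hcard : k + 1 ≤ (cutEdges ends F S).card := by
        by_contra hlt
        have h1 := hF (cutEdges ends F S) hs (by omega) S hS hSu
        obtain ⟨e, he⟩ := Finset.card_pos.1 h1
        simp only [cutEdges, Finset.mem_filter, Finset.mem_sdiff] at he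
        tauto
      refine hcard.trans (Finset.card_le_card_of_injOn
        (fun e => (e, 0, decide ((ends e).2 ∈ S))) (fun e he => hin e he 0 (Or.inr rfl)) ?_)
      intro e _ e' _ hee
      exact (Prod.ext_iff.1 hee).1
  obtain ⟨P, hP, hdisj, hsub⟩ := edmonds (arcEnds ends k) r (k + 1) B hB
  refine ⟨Finset.univ.biUnion P, ?_, ⟨P, hP, hdisj, rfl⟩, ?_⟩
  · intro a ha
    obtain ⟨i, _, hi⟩ := Finset.mem_biUnion.1 ha
    exact ((hmemB a).1 (hsub i hi)).2
  · rw [Finset.sum_biUnion (fun i _ j _ h => hdisj i j h)]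
    have hone : ∀ i ∈ (Finset.univ : Finset (Fin (k + 1))),
        ∑ a ∈ P i, c a.1 ≤ ∑ e ∈ F, c e := by
      intro i _
      rw [← Finset.sum_image (f := c) (arb_inj ends k (P i) (hP i).1)]
      apply Finset.sum_le_sum_of_subset_of_nonneg
      · intro e he
        obtain ⟨a, ha, rfl⟩ := Finset.mem_image.1 he
        exact ((hmemB a).1 (hsub i ha)).1
      · exact fun e _ _ => hc e
    refine (Finset.sum_le_sum hone).trans (le_of_eq ?_)
    simp

theorem stmt5 {V E : Type*} [Fintype V] [DecidableEq V] [Fintype E] [DecidableEq E]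
    (ends : E → V × V) (hloop : ∀ e : E, (ends e).1 ≠ (ends e).2)
    (safeE : Finset E) (c : E → ℝ) (hc : ∀ e, 0 ≤ c e)
    (k : ℕ) (hk : 1 ≤ k) (r : V) (OPT : ℝ)
    (hOPT : IsLeast {x : ℝ | ∃ F : Finset E,
      FGCFeasible ends safeE 1 k F ∧ x = ∑ e ∈ F, c e} OPT) :
    (∃ T : Finset (E × Fin (k + 1) × Bool),
        (∀ a ∈ T, a.1 ∈ safeE ∨ a.2.1 = 0) ∧
        IsKArborescence (arcEnds ends k) r (k + 1) T) ∧
    ∀ T : Finset (E × Fin (k + 1) × Bool),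
      (∀ a ∈ T, a.1 ∈ safeE ∨ a.2.1 = 0) →
      IsKArborescence (arcEnds ends k) r (k + 1) T →
      (∀ T' : Finset (E × Fin (k + 1) × Bool),
        (∀ a ∈ T', a.1 ∈ safeE ∨ a.2.1 = 0) →
        IsKArborescence (arcEnds ends k) r (k + 1) T' →
        ∑ a ∈ T, c a.1 ≤ ∑ a ∈ T', c a.1) →
      FGCFeasible ends safeE 1 k (T.image Prod.fst) ∧
        ∑ e ∈ T.image Prod.fst, c e ≤ ((k : ℝ) + 1) * OPT := by
  obtain ⟨⟨F, hF, hFc⟩, _⟩ := hOPT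
  obtain ⟨T₀, hT₀, hK₀, hcost⟩ := exists_karb ends safeE c hc k r F hF
  refine ⟨⟨T₀, hT₀, hK₀⟩, fun T hT hK hmin => ⟨arb_feasible ends safeE k r T hT hK, ?_⟩⟩
  rw [hFc]
  refine le_trans ?_ ((hmin T₀ hT₀ hK₀).trans hcost)
  exact Finset.sum_image_le_of_nonneg (fun e _ => hc e)
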